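/- Flyspeck Lemma 9922699028: Let K = [4, 6.3504]³ × [6.3504, 8] × [4, 6.3504]², let Δ be the Flyspeck polynomial, l(x) := −π/2 + 1.6294 − 0.2213(√x₂ + √x₃ + √x₅ + √x₆ − 8.0) + 0.913(√x₄ − 2.52) + 0.728(√x₁ − 2.0), and f(x) := l(x) + arctan(∂₄Δ(x)/√(4x₁Δ(x))). Then f(x) ≥ 0 for all x ∈ K. -/

import Mathlib

open Real Set

/-- A function on the half-line that vanishes at `0` and has nonnegative derivative is nonnegative. -/
theorem nonneg_of_hasDerivAt_nonneg {f f' : ℝ → ℝ} (hf : ∀ x, HasDerivAt f (f' x) x)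
    (hf' : ∀ x, 0 ≤ x → 0 ≤ f' x) (h0 : f 0 = 0) {x : ℝ} (hx : 0 ≤ x) : 0 ≤ f x := by
  have hmono : MonotoneOn f (Ici 0) :=
    monotoneOn_of_hasDerivWithinAt_nonneg (convex_Ici 0)
      (fun y _ => (hf y).continuousAt.continuousWithinAt)
      (fun y _ => (hf y).hasDerivWithinAt)
      (fun y hy => hf' y (interior_subset hy))
  simpa [h0] using hmono self_mem_Ici hx hx

theorem cos_le_taylor_four {x : ℝ} (hx : 0 ≤ x) : cos x ≤ 1 - x ^ 2 / 2 + x ^ 4 / 24 := by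
  have key := nonneg_of_hasDerivAt_nonneg (f := fun x => 1 - x ^ 2 / 2 + x ^ 4 / 24 - cos x)
    (f' := fun x => sin x - (x - x ^ 3 / 6))
    (fun x => by
      have h := (((hasDerivAt_const x (1 : ℝ)).sub ((hasDerivAt_pow 2 x).div_const 2)).add
        ((hasDerivAt_pow 4 x).div_const 24)).sub (hasDerivAt_cos x)
      exact h.congr_deriv (by norm_num; ring))
    (fun x hx => sub_nonneg.2 (sin_ge_sub_cube hx)) (by simp) hx
  simpa using key

theorem sin_le_taylor_five {x : ℝ} (hx : 0 ≤ x) : sin x ≤ x - x ^ 3 / 6 + x ^ 5 / 120 := by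
  have key := nonneg_of_hasDerivAt_nonneg (f := fun x => x - x ^ 3 / 6 + x ^ 5 / 120 - sin x)
    (f' := fun x => 1 - x ^ 2 / 2 + x ^ 4 / 24 - cos x)
    (fun x => by
      have h := (((hasDerivAt_id x).sub ((hasDerivAt_pow 3 x).div_const 6)).add
        ((hasDerivAt_pow 5 x).div_const 120)).sub (hasDerivAt_sin x)
      exact h.congr_deriv (by norm_num; ring))
    (fun x hx => sub_nonneg.2 (cos_le_taylor_four hx)) (by simp) hx
  simpa using key

theorem taylor_six_le_cos {x : ℝ} (hx : 0 ≤ x) :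
    1 - x ^ 2 / 2 + x ^ 4 / 24 - x ^ 6 / 720 ≤ cos x := by
  have key := nonneg_of_hasDerivAt_nonneg
    (f := fun x => cos x - (1 - x ^ 2 / 2 + x ^ 4 / 24 - x ^ 6 / 720))
    (f' := fun x => x - x ^ 3 / 6 + x ^ 5 / 120 - sin x)
    (fun x => by
      have h := (hasDerivAt_cos x).sub
        ((((hasDerivAt_const x (1 : ℝ)).sub ((hasDerivAt_pow 2 x).div_const 2)).add
        ((hasDerivAt_pow 4 x).div_const 24)).sub ((hasDerivAt_pow 6 x).div_const 720))
      exact h.congr_deriv (by norm_num; ring))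
    (fun x hx => sub_nonneg.2 (sin_le_taylor_five hx)) (by simp) hx
  simpa using key

theorem taylor_seven_le_sin {x : ℝ} (hx : 0 ≤ x) :
    x - x ^ 3 / 6 + x ^ 5 / 120 - x ^ 7 / 5040 ≤ sin x := by
  have key := nonneg_of_hasDerivAt_nonneg
    (f := fun x => sin x - (x - x ^ 3 / 6 + x ^ 5 / 120 - x ^ 7 / 5040))
    (f' := fun x => cos x - (1 - x ^ 2 / 2 + x ^ 4 / 24 - x ^ 6 / 720))
    (fun x => by
      have h := (hasDerivAt_sin x).sub
        ((((hasDerivAt_id x).sub ((hasDerivAt_pow 3 x).div_const 6)).add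
        ((hasDerivAt_pow 5 x).div_const 120)).sub ((hasDerivAt_pow 7 x).div_const 5040))
      exact h.congr_deriv (by norm_num; ring))
    (fun x hx => sub_nonneg.2 (taylor_six_le_cos hx)) (by simp) hx
  simpa using key

/-- The logarithm of a positive concave function is concave. -/
theorem ConcaveOn.log_of_pos {s : Set ℝ} {f : ℝ → ℝ} (hf : ConcaveOn ℝ s f)
    (hpos : ∀ x ∈ s, 0 < f x) : ConcaveOn ℝ s fun x => log (f x) := by
  refine ⟨hf.1, fun x hx y hy a b ha hb hab => ?_⟩
  refine (strictConcaveOn_log_Ioi.concaveOn.2 (hpos x hx) (hpos y hy) ha hb hab).trans ?_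
  exact log_le_log (strictConcaveOn_log_Ioi.1 (hpos x hx) (hpos y hy) ha hb hab)
    (hf.2 hx hy ha hb hab)

theorem concaveOn_affine {s : Set ℝ} (hs : Convex ℝ s) (m k : ℝ) :
    ConcaveOn ℝ s fun x => m + k * x := by
  refine ⟨hs, fun x _ y _ a b _ _ hab => le_of_eq ?_⟩
  simp only [smul_eq_mul]
  linear_combination m * hab

theorem concaveOn_sin_affine {s : Set ℝ} (hs : Convex ℝ s) {m k : ℝ}
    (h : ∀ x ∈ s, m + k * x ∈ Icc 0 π) : ConcaveOn ℝ s fun x => sin (m + k * x) := by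
  refine ⟨hs, fun x hx y hy a b ha hb hab => ?_⟩
  convert strictConcaveOn_sin_Icc.concaveOn.2 (h x hx) (h y hy) ha hb hab using 2
  simp only [smul_eq_mul]
  linear_combination (-m) * hab

theorem ConcaveOn.le_of_le_endpoints {f : ℝ → ℝ} {p q c x : ℝ} (hf : ConcaveOn ℝ (Icc p q) f)
    (hx : x ∈ Icc p q) (hp : c ≤ f p) (hq : c ≤ f q) : c ≤ f x :=
  have hpq : p ≤ q := hx.1.trans hx.2
  (le_min hp hq).trans
    (hf.min_le_of_mem_Icc (left_mem_Icc.2 hpq) (right_mem_Icc.2 hpq) hx)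

/-- Half of the bound on the dihedral angle at an edge of length `w`, opposite to an edge of
length `y`, when both adjacent faces have side lengths `w`, `a`, `b`. -/
noncomputable def halfAngle (w a b y : ℝ) : ℝ :=
  (1.6294 - 0.4426 * (a + b - 4) + 0.913 * (y - 2.52) + 0.728 * (w - 2)) / 2

/-- Sixteen times the squared area of the triangle with side lengths `w`, `a`, `b`. -/
def heron (w a b : ℝ) : ℝ := ((a + b) ^ 2 - w ^ 2) * (w ^ 2 - (a - b) ^ 2)

theorem halfAngle_bounds {w a b y : ℝ} (hw : w ∈ Icc (2 : ℝ) 2.52) (ha : a ∈ Icc (2 : ℝ) 2.52)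
    (hb : b ∈ Icc (2 : ℝ) 2.52) (hy : y ∈ Icc (2.52 : ℝ) √8) :
    halfAngle w a b y ∈ Icc (0.5 : ℝ) 1.2 := by
  obtain ⟨hw1, hw2⟩ := hw
  obtain ⟨ha1, ha2⟩ := ha
  obtain ⟨hb1, hb2⟩ := hb
  obtain ⟨hy1, hy2⟩ := hy
  have h8 : √8 ≤ 2.83 := by rw [sqrt_le_left (by norm_num)]; norm_num
  unfold halfAngle
  constructor <;> norm_num at * <;> linarith

theorem sin_halfAngle_pos {w a b y : ℝ} (hw : w ∈ Icc (2 : ℝ) 2.52) (ha : a ∈ Icc (2 : ℝ) 2.52)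
    (hb : b ∈ Icc (2 : ℝ) 2.52) (hy : y ∈ Icc (2.52 : ℝ) √8) :
    0 < sin (halfAngle w a b y) := by
  have h := halfAngle_bounds hw ha hb hy
  have hpi := pi_gt_three
  exact sin_pos_of_pos_of_lt_pi (by linarith [h.1]) (by linarith [h.2])

theorem heron_factors_pos {w a b : ℝ} (hw : w ∈ Icc (2 : ℝ) 2.52) (ha : a ∈ Icc (2 : ℝ) 2.52)
    (hb : b ∈ Icc (2 : ℝ) 2.52) :
    0 < a + b - w ∧ 0 < a + b + w ∧ 0 < w ^ 2 - (a - b) ^ 2 := by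
  obtain ⟨hw1, hw2⟩ := hw
  obtain ⟨ha1, ha2⟩ := ha
  obtain ⟨hb1, hb2⟩ := hb
  norm_num at *
  exact ⟨by linarith, by linarith, by nlinarith⟩

theorem heron_pos {w a b : ℝ} (hw : w ∈ Icc (2 : ℝ) 2.52) (ha : a ∈ Icc (2 : ℝ) 2.52)
    (hb : b ∈ Icc (2 : ℝ) 2.52) : 0 < heron w a b := by
  obtain ⟨h1, h2, h3⟩ := heron_factors_pos hw ha hb
  have : heron w a b = (a + b - w) * (a + b + w) * (w ^ 2 - (a - b) ^ 2) := by
    unfold heron; ring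
  rw [this]
  positivity

theorem heron_comm (w a b : ℝ) : heron w a b = heron w b a := by unfold heron; ring

theorem halfAngle_comm (w a b y : ℝ) : halfAngle w a b y = halfAngle w b a y := by
  unfold halfAngle; ring

theorem halfAngle_eq_side (w a b y : ℝ) :
    halfAngle w a b y = halfAngle w 0 b y + (-0.2213) * a := by unfold halfAngle; ring

theorem halfAngle_eq_edge (w a b y : ℝ) :
    halfAngle w a b y = halfAngle 0 a b y + 0.364 * w := by unfold halfAngle; ring

theorem halfAngle_eq_opposite (w a b y : ℝ) :
    halfAngle w a b y = halfAngle w a b 0 + 0.4565 * y := by unfold halfAngle; ring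

theorem mem_Icc_zero_pi {x : ℝ} (hx : x ∈ Icc (0.5 : ℝ) 1.2) : x ∈ Icc 0 π :=
  ⟨by linarith [hx.1], by linarith [hx.2, pi_gt_three]⟩

/-- If the half-angle inequality holds at the extreme values of the side `a`, it holds for `a`. -/
theorem half_angle_ineq_of_sides {w a b y : ℝ} (hw : w ∈ Icc (2 : ℝ) 2.52)
    (ha : a ∈ Icc (2 : ℝ) 2.52) (hb : b ∈ Icc (2 : ℝ) 2.52) (hy : y ∈ Icc (2.52 : ℝ) √8)
    (hl : y ^ 2 * w ^ 2 ≤ heron w 2 b * sin (halfAngle w 2 b y) ^ 2)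
    (hr : y ^ 2 * w ^ 2 ≤ heron w 2.52 b * sin (halfAngle w 2.52 b y) ^ 2) :
    y ^ 2 * w ^ 2 ≤ heron w a b * sin (halfAngle w a b y) ^ 2 := by
  have hI := convex_Icc (𝕜 := ℝ) (2 : ℝ) 2.52
  have hsum : ConcaveOn ℝ (Icc (2 : ℝ) 2.52) fun a => a + b - w :=
    (concaveOn_affine hI (b - w) 1).congr fun x _ => by ring
  have hsum' : ConcaveOn ℝ (Icc (2 : ℝ) 2.52) fun a => a + b + w :=
    (concaveOn_affine hI (b + w) 1).congr fun x _ => by ring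
  have hdiff : ConcaveOn ℝ (Icc (2 : ℝ) 2.52) fun a => w ^ 2 - (a - b) ^ 2 := by
    refine ⟨hI, fun x _ z _ s t hs ht hst => ?_⟩
    simp only [smul_eq_mul]
    obtain rfl : t = 1 - s := by linarith
    nlinarith [mul_nonneg (mul_nonneg hs ht) (sq_nonneg (x - z))]
  have hsin : ConcaveOn ℝ (Icc (2 : ℝ) 2.52) fun a => sin (halfAngle w a b y) := by
    refine (concaveOn_sin_affine hI (m := halfAngle w 0 b y) (k := -0.2213) fun x hx => ?_).congr
      fun x _ => by simp only [← halfAngle_eq_side]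
    rw [← halfAngle_eq_side]
    exact mem_Icc_zero_pi (halfAngle_bounds hw hx hb hy)
  have hsin2 : ConcaveOn ℝ (Icc (2 : ℝ) 2.52) fun a => 2 * log (sin (halfAngle w a b y)) :=
    (hsin.log_of_pos fun x hx => sin_halfAngle_pos hw hx hb hy).smul zero_le_two
  have hconc := (((hsum.log_of_pos fun x hx => (heron_factors_pos hw hx hb).1).add
    (hsum'.log_of_pos fun x hx => (heron_factors_pos hw hx hb).2.1)).add
    (hdiff.log_of_pos fun x hx => (heron_factors_pos hw hx hb).2.2)).add
    hsin2
  have hlog : ∀ x ∈ Icc (2 : ℝ) 2.52, log (heron w x b * sin (halfAngle w x b y) ^ 2) =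
      log (x + b - w) + log (x + b + w) + log (w ^ 2 - (x - b) ^ 2)
        + 2 * log (sin (halfAngle w x b y)) := by
    intro x hx
    obtain ⟨h1, h2, h3⟩ := heron_factors_pos hw hx hb
    have h4 := sin_halfAngle_pos hw hx hb hy
    rw [← log_mul h1.ne' h2.ne', ← log_mul (by positivity) h3.ne',
      show (2 : ℝ) * log (sin (halfAngle w x b y)) = log (sin (halfAngle w x b y) ^ 2) by
        rw [log_pow]; norm_num, ← log_mul (by positivity) (by positivity)]
    congr 1
    unfold heron
    ring
  have hpos : 0 < y ^ 2 * w ^ 2 := by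
    have := hw.1
    have := hy.1
    have : 0 < w := by linarith
    have : 0 < y := by linarith
    positivity
  have h2 : (2 : ℝ) ∈ Icc (2 : ℝ) 2.52 := by norm_num
  have h252 : (2.52 : ℝ) ∈ Icc (2 : ℝ) 2.52 := by norm_num
  have hl' := log_le_log hpos hl
  have hr' := log_le_log hpos hr
  rw [hlog _ h2] at hl'
  rw [hlog _ h252] at hr'
  have hx := hconc.le_of_le_endpoints ha hl' hr'
  refine (log_le_log_iff hpos ?_).1 ((hlog a ha).symm ▸ hx)
  exact mul_pos (heron_pos hw ha hb) (pow_pos (sin_halfAngle_pos hw ha hb hy) 2)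

/-- If the half-angle inequality holds at the extreme values of the edge `w`, it holds for `w`. -/
theorem half_angle_ineq_of_edges {w a b y : ℝ} (hw : w ∈ Icc (2 : ℝ) 2.52)
    (ha : a ∈ Icc (2 : ℝ) 2.52) (hb : b ∈ Icc (2 : ℝ) 2.52) (hy : y ∈ Icc (2.52 : ℝ) √8)
    (hl : y ^ 2 * 2 ^ 2 ≤ heron 2 a b * sin (halfAngle 2 a b y) ^ 2)
    (hr : y ^ 2 * 2.52 ^ 2 ≤ heron 2.52 a b * sin (halfAngle 2.52 a b y) ^ 2) :
    y ^ 2 * w ^ 2 ≤ heron w a b * sin (halfAngle w a b y) ^ 2 := by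
  have hI := convex_Icc (𝕜 := ℝ) (2 : ℝ) 2.52
  have hwpos : ∀ x ∈ Icc (2 : ℝ) 2.52, 0 < x := fun x hx => by linarith [hx.1]
  have hinv : ConvexOn ℝ (Icc (2 : ℝ) 2.52) fun x : ℝ => x ^ (-2 : ℤ) :=
    (convexOn_zpow (-2)).subset hwpos hI
  have hsq : ConvexOn ℝ (Icc (2 : ℝ) 2.52) fun x : ℝ => x ^ 2 :=
    (convexOn_pow 2).subset (fun x hx => (hwpos x hx).le) hI
  have hquot : ConcaveOn ℝ (Icc (2 : ℝ) 2.52) fun x => heron x a b / x ^ 2 := by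
    have h := ((concaveOn_const ((a + b) ^ 2 + (a - b) ^ 2) hI).sub hsq).sub
      (hinv.smul (mul_nonneg (sq_nonneg (a + b)) (sq_nonneg (a - b))))
    refine h.congr fun x hx => ?_
    have hx0 := (hwpos x hx).ne'
    simp only [Pi.sub_apply, smul_eq_mul, zpow_neg]
    unfold heron
    norm_cast
    field_simp
    ring
  have hsin : ConcaveOn ℝ (Icc (2 : ℝ) 2.52) fun w => sin (halfAngle w a b y) := by
    refine (concaveOn_sin_affine hI (m := halfAngle 0 a b y) (k := 0.364) fun x hx => ?_).congr
      fun x _ => by simp only [← halfAngle_eq_edge]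
    rw [← halfAngle_eq_edge]
    exact mem_Icc_zero_pi (halfAngle_bounds hx ha hb hy)
  have hquot_pos : ∀ x ∈ Icc (2 : ℝ) 2.52, 0 < heron x a b / x ^ 2 := fun x hx =>
    div_pos (heron_pos hx ha hb) (pow_pos (hwpos x hx) 2)
  have hsin2 : ConcaveOn ℝ (Icc (2 : ℝ) 2.52) fun w => 2 * log (sin (halfAngle w a b y)) :=
    (hsin.log_of_pos fun x hx => sin_halfAngle_pos hx ha hb hy).smul zero_le_two
  have hconc := (hquot.log_of_pos hquot_pos).add
    hsin2
  have hypos : 0 < y := by linarith [hy.1]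
  have hiff : ∀ x ∈ Icc (2 : ℝ) 2.52,
      (y ^ 2 * x ^ 2 ≤ heron x a b * sin (halfAngle x a b y) ^ 2 ↔
        log (y ^ 2) ≤ log (heron x a b / x ^ 2) + 2 * log (sin (halfAngle x a b y))) := by
    intro x hx
    have hx0 := hwpos x hx
    have h1 := hquot_pos x hx
    have h2 := sin_halfAngle_pos hx ha hb hy
    rw [show (2 : ℝ) * log (sin (halfAngle x a b y)) = log (sin (halfAngle x a b y) ^ 2) by
        rw [log_pow]; norm_num, ← log_mul h1.ne' (by positivity),
      log_le_log_iff (by positivity) (by positivity), div_mul_eq_mul_div, le_div_iff₀ (by positivity)]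
  exact (hiff w hw).2 (hconc.le_of_le_endpoints hw ((hiff 2 (by norm_num)).1 hl)
    ((hiff 2.52 (by norm_num)).1 hr))

/-- If the half-angle inequality holds at the extreme values of the opposite edge `y`, it holds
for `y`. -/
theorem half_angle_ineq_of_opposites {w a b y : ℝ} (hw : w ∈ Icc (2 : ℝ) 2.52)
    (ha : a ∈ Icc (2 : ℝ) 2.52) (hb : b ∈ Icc (2 : ℝ) 2.52) (hy : y ∈ Icc (2.52 : ℝ) √8)
    (hl : 2.52 ^ 2 * w ^ 2 ≤ heron w a b * sin (halfAngle w a b 2.52) ^ 2)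
    (hr : √8 ^ 2 * w ^ 2 ≤ heron w a b * sin (halfAngle w a b √8) ^ 2) :
    y ^ 2 * w ^ 2 ≤ heron w a b * sin (halfAngle w a b y) ^ 2 := by
  have hI := convex_Icc (𝕜 := ℝ) (2.52 : ℝ) √8
  have hsin : ConcaveOn ℝ (Icc (2.52 : ℝ) √8) fun y => sin (halfAngle w a b y) := by
    refine (concaveOn_sin_affine hI (m := halfAngle w a b 0) (k := 0.4565) fun x hx => ?_).congr
      fun x _ => by simp only [← halfAngle_eq_opposite]
    rw [← halfAngle_eq_opposite]
    exact mem_Icc_zero_pi (halfAngle_bounds hw ha hb hx)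
  have hmul : ConcaveOn ℝ (Icc (2.52 : ℝ) √8) fun y =>
      √(heron w a b) * sin (halfAngle w a b y) := hsin.smul (sqrt_nonneg (heron w a b))
  have hconc := hmul.add (concaveOn_affine hI 0 (-w))
  have hw0 : 0 < w := by linarith [hw.1]
  have hiff : ∀ x ∈ Icc (2.52 : ℝ) √8,
      (x ^ 2 * w ^ 2 ≤ heron w a b * sin (halfAngle w a b x) ^ 2 ↔
        0 ≤ √(heron w a b) * sin (halfAngle w a b x) + (0 + -w * x)) := by
    intro x hx
    have hx0 : 0 < x := by linarith [hx.1]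
    have h1 := sin_halfAngle_pos hw ha hb hx
    rw [← mul_pow, ← sq_sqrt (heron_pos hw ha hb).le, ← mul_pow,
      pow_le_pow_iff_left₀ (by positivity) (by positivity) two_ne_zero,
      sqrt_sq (sqrt_nonneg _), ← sub_nonneg]
    ring_nf
  have h := hy.1.trans hy.2
  exact (hiff y hy).2 (hconc.le_of_le_endpoints hy ((hiff _ (left_mem_Icc.2 h)).1 hl)
    ((hiff _ (right_mem_Icc.2 h)).1 hr))

theorem half_angle_ineq_of_taylor {w a b y r : ℝ} (hH : 0 ≤ heron w a b) (hr : 0 ≤ r)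
    (hrx : r ≤ halfAngle w a b y) (hx : halfAngle w a b y ≤ 1.2)
    (h : 0 ≤ r - r ^ 3 / 6 + r ^ 5 / 120 - r ^ 7 / 5040)
    (h' : y ^ 2 * w ^ 2 ≤ heron w a b * (r - r ^ 3 / 6 + r ^ 5 / 120 - r ^ 7 / 5040) ^ 2) :
    y ^ 2 * w ^ 2 ≤ heron w a b * sin (halfAngle w a b y) ^ 2 := by
  have hpi := pi_gt_three
  refine h'.trans (mul_le_mul_of_nonneg_left (pow_le_pow_left₀ h ?_ 2) hH)
  exact (taylor_seven_le_sin hr).trans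
    (sin_le_sin_of_le_of_le_pi_div_two (by linarith) (by linarith) hrx)

/-- The half-angle inequality at the vertices of the box. -/
theorem half_angle_ineq_vertex {w a b y : ℝ} (hw : w = 2 ∨ w = 2.52) (ha : a = 2 ∨ a = 2.52)
    (hb : b = 2 ∨ b = 2.52) (hy : y = 2.52 ∨ y = √8) :
    y ^ 2 * w ^ 2 ≤ heron w a b * sin (halfAngle w a b y) ^ 2 := by
  have h8 : (2.828427 : ℝ) ≤ √8 := le_sqrt_of_sq_le (by norm_num)
  have h252 : (2.52 : ℝ) ≤ √8 := by linarith
  have hw' : w ∈ Icc (2 : ℝ) 2.52 := by rcases hw with rfl | rfl <;> norm_num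
  have ha' : a ∈ Icc (2 : ℝ) 2.52 := by rcases ha with rfl | rfl <;> norm_num
  have hb' : b ∈ Icc (2 : ℝ) 2.52 := by rcases hb with rfl | rfl <;> norm_num
  have hH := (heron_pos hw' ha' hb').le
  rcases hy with rfl | rfl
  · refine half_angle_ineq_of_taylor (r := halfAngle w a b 2.52) hH ?_ le_rfl
      (halfAngle_bounds hw' ha' hb' (left_mem_Icc.2 h252)).2 ?_ ?_ <;>
    rcases hw with rfl | rfl <;> rcases ha with rfl | rfl <;> rcases hb with rfl | rfl <;>
    norm_num [halfAngle, heron]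
  · refine half_angle_ineq_of_taylor (r := halfAngle w a b 2.828427) hH ?_
      (by unfold halfAngle; linarith)
      (halfAngle_bounds hw' ha' hb' (right_mem_Icc.2 h252)).2 ?_ ?_ <;>
    rcases hw with rfl | rfl <;> rcases ha with rfl | rfl <;> rcases hb with rfl | rfl <;>
    norm_num [halfAngle, heron]

theorem half_angle_ineq {w a b y : ℝ} (hw : w ∈ Icc (2 : ℝ) 2.52)
    (ha : a ∈ Icc (2 : ℝ) 2.52) (hb : b ∈ Icc (2 : ℝ) 2.52) (hy : y ∈ Icc (2.52 : ℝ) √8) :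
    y ^ 2 * w ^ 2 ≤ heron w a b * sin (halfAngle w a b y) ^ 2 := by
  have h2 : (2 : ℝ) ∈ Icc (2 : ℝ) 2.52 := by norm_num
  have h252 : (2.52 : ℝ) ∈ Icc (2 : ℝ) 2.52 := by norm_num
  have hle := hy.1.trans hy.2
  have hside : ∀ {w b y}, (w = 2 ∨ w = 2.52) → (b = 2 ∨ b = 2.52) → (y = 2.52 ∨ y = √8) →
      y ^ 2 * w ^ 2 ≤ heron w a b * sin (halfAngle w a b y) ^ 2 := by
    intro w b y hw hb hy
    refine half_angle_ineq_of_sides ?_ ha ?_ ?_ (half_angle_ineq_vertex hw (.inl rfl) hb hy)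
      (half_angle_ineq_vertex hw (.inr rfl) hb hy)
    · rcases hw with rfl | rfl <;> assumption
    · rcases hb with rfl | rfl <;> assumption
    · rcases hy with rfl | rfl
      exacts [left_mem_Icc.2 hle, right_mem_Icc.2 hle]
  have hsides : ∀ {w y}, (w = 2 ∨ w = 2.52) → (y = 2.52 ∨ y = √8) →
      y ^ 2 * w ^ 2 ≤ heron w a b * sin (halfAngle w a b y) ^ 2 := by
    intro w y hw hy
    rw [heron_comm, halfAngle_comm]
    refine half_angle_ineq_of_sides ?_ hb ha ?_ ?_ ?_
    · rcases hw with rfl | rfl <;> assumption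
    · rcases hy with rfl | rfl
      exacts [left_mem_Icc.2 hle, right_mem_Icc.2 hle]
    · rw [heron_comm, halfAngle_comm]
      exact hside hw (.inl rfl) hy
    · rw [heron_comm, halfAngle_comm]
      exact hside hw (.inr rfl) hy
  refine half_angle_ineq_of_opposites hw ha hb hy ?_ ?_
  · exact half_angle_ineq_of_edges hw ha hb (left_mem_Icc.2 hle)
      (hsides (.inl rfl) (.inl rfl)) (hsides (.inr rfl) (.inl rfl))
  · exact half_angle_ineq_of_edges hw ha hb (right_mem_Icc.2 hle)
      (hsides (.inl rfl) (.inr rfl)) (hsides (.inr rfl) (.inr rfl))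

/-- Sixteen times the squared area of the triangle with squared side lengths `u`, `v`, `w`. -/
def triangleForm (u v w : ℝ) : ℝ := 2 * u * (v + w) - u ^ 2 - (v - w) ^ 2

theorem heron_eq_triangleForm (w a b : ℝ) :
    heron w a b = triangleForm (w ^ 2) (a ^ 2) (b ^ 2) := by
  unfold heron triangleForm; ring

theorem sqrt_triangleForm_mem {u v w : ℝ} (hu : u ∈ Icc (4 : ℝ) 6.3504)
    (hv : v ∈ Icc (4 : ℝ) 6.3504) (hw : w ∈ Icc (4 : ℝ) 6.3504) :
    √(triangleForm u v w) ∈ Icc (6 : ℝ) 12 := by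
  obtain ⟨hu1, hu2⟩ := hu
  obtain ⟨hv1, hv2⟩ := hv
  obtain ⟨hw1, hw2⟩ := hw
  constructor
  · refine le_sqrt_of_sq_le ?_
    unfold triangleForm
    nlinarith [mul_nonneg (sub_nonneg.2 hu1) (sub_nonneg.2 hu2),
      mul_nonneg (sub_nonneg.2 hv1) (sub_nonneg.2 hv2),
      mul_nonneg (sub_nonneg.2 hw1) (sub_nonneg.2 hw2),
      mul_nonneg (sub_nonneg.2 hu1) (sub_nonneg.2 hv1),
      mul_nonneg (sub_nonneg.2 hu1) (sub_nonneg.2 hw1),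
      mul_nonneg (sub_nonneg.2 hv1) (sub_nonneg.2 hw1)]
  · rw [sqrt_le_left (by norm_num)]
    unfold triangleForm
    nlinarith [mul_nonneg (sub_nonneg.2 hu2) (sub_nonneg.2 hv1), sq_nonneg (v - w),
      mul_nonneg (sub_nonneg.2 hu2) (sub_nonneg.2 hw1)]

theorem sin_mul_sin_le (x y : ℝ) : 2 * (sin x * sin y) ≤ 1 - cos (x + y) := by
  have h1 := cos_le_one (x - y)
  rw [cos_sub] at h1
  rw [cos_add]
  linarith

theorem le_arctan_div_sqrt {p d r θ : ℝ} (hr : 0 < r) (hd : 0 < d) (h : p ^ 2 + d = r ^ 2)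
    (hθ : θ ∈ Icc (-(π / 2)) (π / 2)) (hp : r * sin θ ≤ p) : θ ≤ arctan (p / √d) := by
  have hs : 0 < √d := sqrt_pos.2 hd
  have h1 : 1 + (p / √d) ^ 2 = (r / √d) ^ 2 := by
    rw [div_pow, div_pow, sq_sqrt hd.le, ← h]
    field_simp
    ring
  have h2 : p / √d / (r / √d) = p / r := by field_simp
  have habs : |p / r| ≤ 1 := by
    rw [← sq_le_one_iff_abs_le_one, div_pow, div_le_one (by positivity)]
    linarith
  rw [arctan_eq_arcsin, h1, sqrt_sq (by positivity), h2,
    le_arcsin_iff_sin_le hθ (abs_le.1 habs), le_div_iff₀ hr]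
  linarith

theorem sqrt_mem_Icc {x : ℝ} (hx : x ∈ Icc (4 : ℝ) 6.3504) : √x ∈ Icc (2 : ℝ) 2.52 := by
  refine ⟨le_sqrt_of_sq_le (by linarith [hx.1]), ?_⟩
  rw [sqrt_le_left (by norm_num)]
  norm_num at hx ⊢
  exact hx.2


/-- Flyspeck Lemma 9922699028. -/
theorem flyspeck_9922699028
    (x₁ x₂ x₃ x₄ x₅ x₆ : ℝ)
    (h₁ : x₁ ∈ Set.Icc (4 : ℝ) 6.3504) (h₂ : x₂ ∈ Set.Icc (4 : ℝ) 6.3504)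
    (h₃ : x₃ ∈ Set.Icc (4 : ℝ) 6.3504) (h₄ : x₄ ∈ Set.Icc (6.3504 : ℝ) 8)
    (h₅ : x₅ ∈ Set.Icc (4 : ℝ) 6.3504) (h₆ : x₆ ∈ Set.Icc (4 : ℝ) 6.3504) :
    (-(Real.pi / 2) + 1.6294
        - 0.2213 * (Real.sqrt x₂ + Real.sqrt x₃ + Real.sqrt x₅ + Real.sqrt x₆ - 8.0)
        + 0.913 * (Real.sqrt x₄ - 2.52) + 0.728 * (Real.sqrt x₁ - 2.0))
      + Real.arctan
        ((x₁ * (-x₁ + x₂ + x₃ - x₄ + x₅ + x₆) - x₁ * x₄ + x₂ * x₅ + x₃ * x₆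
            - x₂ * x₃ - x₅ * x₆)
          / Real.sqrt (4 * x₁ *
            (x₁ * x₄ * (-x₁ + x₂ + x₃ - x₄ + x₅ + x₆)
              + x₂ * x₅ * (x₁ - x₂ + x₃ + x₄ - x₅ + x₆)
              + x₃ * x₆ * (x₁ + x₂ - x₃ + x₄ + x₅ - x₆)
              - x₂ * x₃ * x₄ - x₁ * x₃ * x₅ - x₁ * x₂ * x₆ - x₄ * x₅ * x₆)))
      ≥ 0 := by
  have s₁ := sqrt_mem_Icc h₁
  have s₂ := sqrt_mem_Icc h₂
  have s₃ := sqrt_mem_Icc h₃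
  have s₅ := sqrt_mem_Icc h₅
  have s₆ := sqrt_mem_Icc h₆
  have s₄ : √x₄ ∈ Set.Icc (2.52 : ℝ) √8 :=
    ⟨le_sqrt_of_sq_le (by norm_num at h₄ ⊢; exact h₄.1), sqrt_le_sqrt h₄.2⟩
  have pos₁ : 0 < x₁ := by linarith [h₁.1]
  have pos₄ : 0 < x₄ := by linarith [h₄.1]
  have pos_of_mem {x : ℝ} (hx : x ∈ Set.Icc (4 : ℝ) 6.3504) : √x ^ 2 = x :=
    sq_sqrt (by linarith [hx.1])
  have hU := half_angle_ineq s₁ s₂ s₆ s₄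
  have hV := half_angle_ineq s₁ s₃ s₅ s₄
  have hα := halfAngle_bounds s₁ s₂ s₆ s₄
  have hβ := halfAngle_bounds s₁ s₃ s₅ s₄
  have hsα := sin_halfAngle_pos s₁ s₂ s₆ s₄
  have hsβ := sin_halfAngle_pos s₁ s₃ s₅ s₄
  rw [heron_eq_triangleForm, pos_of_mem h₁, pos_of_mem h₂, pos_of_mem h₆, sq_sqrt pos₄.le] at hU
  rw [heron_eq_triangleForm, pos_of_mem h₁, pos_of_mem h₃, pos_of_mem h₅, sq_sqrt pos₄.le] at hV
  have hL : -(π / 2) + 1.6294 - 0.2213 * (√x₂ + √x₃ + √x₅ + √x₆ - 8.0)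
      + 0.913 * (√x₄ - 2.52) + 0.728 * (√x₁ - 2.0)
      = halfAngle √x₁ √x₂ √x₆ √x₄ + halfAngle √x₁ √x₃ √x₅ √x₄ - π / 2 := by
    unfold halfAngle; norm_num; ring
  rw [hL]
  generalize halfAngle √x₁ √x₂ √x₆ √x₄ = α at *
  generalize halfAngle √x₁ √x₃ √x₅ √x₄ = β at *
  have mU := sqrt_triangleForm_mem h₁ h₂ h₆
  have mV := sqrt_triangleForm_mem h₁ h₃ h₅
  have sqU := sq_sqrt (sqrt_pos.1 (by linarith [mU.1] : 0 < √(triangleForm x₁ x₂ x₆))).le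
  have sqV := sq_sqrt (sqrt_pos.1 (by linarith [mV.1] : 0 < √(triangleForm x₁ x₃ x₅))).le
  rw [← sqU] at hU
  rw [← sqV] at hV
  generalize √(triangleForm x₁ x₂ x₆) = u at *
  generalize √(triangleForm x₁ x₃ x₅) = v at *
  unfold triangleForm at sqU sqV
  obtain ⟨hu1, hu2⟩ := mU
  obtain ⟨hv1, hv2⟩ := mV
  have hu0 : 0 < u := by linarith
  have hv0 : 0 < v := by linarith
  set P := x₁ * (-x₁ + x₂ + x₃ - x₄ + x₅ + x₆) - x₁ * x₄ + x₂ * x₅ + x₃ * x₆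
    - x₂ * x₃ - x₅ * x₆ with hP
  set D := 4 * x₁ * (x₁ * x₄ * (-x₁ + x₂ + x₃ - x₄ + x₅ + x₆)
    + x₂ * x₅ * (x₁ - x₂ + x₃ + x₄ - x₅ + x₆) + x₃ * x₆ * (x₁ + x₂ - x₃ + x₄ + x₅ - x₆)
    - x₂ * x₃ * x₄ - x₁ * x₃ * x₅ - x₁ * x₂ * x₆ - x₄ * x₅ * x₆) with hD
  have hPD : P ^ 2 + D = (u * v) ^ 2 := by
    rw [mul_pow, sqU, sqV, hP, hD]; ring
  have hprod : x₄ * x₁ ≤ u * v * (sin α * sin β) := by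
    have h := mul_le_mul hU hV (by positivity) (by positivity)
    refine (pow_le_pow_iff_left₀ (by positivity) (by positivity) two_ne_zero).1 ?_
    calc (x₄ * x₁) ^ 2 = x₄ * x₁ * (x₄ * x₁) := by ring
      _ ≤ _ := h
      _ = _ := by ring
  have hlower : u * v - 2 * (x₄ * x₁) ≤ P := by
    have h1 := sq_nonneg (u - v)
    have h2 := sq_nonneg (x₂ - x₆ - (x₃ - x₅))
    linarith
  have hcos : u * v * cos (α + β) ≤ P := by
    linarith [mul_le_mul_of_nonneg_left (sin_mul_sin_le α β) (mul_pos hu0 hv0).le]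
  have hpi := pi_gt_three
  have hcos' : -1 < cos (α + β) := by
    rw [← cos_pi]
    exact cos_lt_cos_of_nonneg_of_le_pi (by linarith [hα.1, hβ.1]) le_rfl
      (by linarith [hα.2, hβ.2])
  have hupper : P < u * v := by
    have h1 : (u - v) ^ 2 ≤ 36 := by nlinarith
    have h2 : (x₂ - x₆ - (x₃ - x₅)) ^ 2 ≤ 25 := by
      have hle : |x₂ - x₆ - (x₃ - x₅)| ≤ 5 := by
        rw [abs_le]
        constructor <;> linarith [h₂.1, h₂.2, h₃.1, h₃.2, h₅.1, h₅.2, h₆.1, h₆.2]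
      calc (x₂ - x₆ - (x₃ - x₅)) ^ 2 = |x₂ - x₆ - (x₃ - x₅)| ^ 2 := (sq_abs _).symm
        _ ≤ 5 ^ 2 := pow_le_pow_left₀ (abs_nonneg _) hle 2
        _ = 25 := by norm_num
    have h3 : 6 * 4 ≤ x₄ * x₁ :=
      mul_le_mul (by linarith [h₄.1]) h₁.1 (by norm_num) pos₄.le
    linarith
  have hDpos : 0 < D := by
    have h := mul_pos (mul_pos hu0 hv0) (by linarith : 0 < 1 + cos (α + β))
    linarith [mul_pos (sub_pos.2 hupper) (by linarith : 0 < u * v + P)]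
  have hfinal := le_arctan_div_sqrt (mul_pos hu0 hv0) hDpos hPD (θ := π / 2 - (α + β))
    ⟨by linarith [hα.2, hβ.2], by linarith [hα.1, hβ.1]⟩ (by rwa [sin_pi_div_two_sub])
  linarith
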